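/- Let X be a Banach space, L : X → X a linear map with ‖L(x)‖ ≤ λ‖x‖ for all x, where 0 ≤ λ < 1, and B : X × X → X a bilinear map with ‖B(x,y)‖ ≤ γ‖x‖‖y‖ for all x, y, with γ > 0. Then for every x₁ ∈ X with ‖x₁‖ < (1-λ)²/(4γ), the sequence defined by x⁽⁰⁾ = 0 and x⁽ⁿ⁺¹⁾ = x₁ + L(x⁽ⁿ⁾) + B(x⁽ⁿ⁾, x⁽ⁿ⁾) converges in X to a solution x of x = x₁ + L(x) + B(x,x), and this solution is the unique one satisfying 2γ‖x‖ ≤ 1 - λ. -/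

import Mathlib

open Filter Topology

theorem norm_picard_sub_le {X : Type*} [NormedAddCommGroup X] [NormedSpace ℝ X]
    {L : X →ₗ[ℝ] X} {B : X →ₗ[ℝ] X →ₗ[ℝ] X} {lam gam : ℝ}
    (hL : ∀ x : X, ‖L x‖ ≤ lam * ‖x‖) (hB : ∀ x y : X, ‖B x y‖ ≤ gam * ‖x‖ * ‖y‖) (a u v : X) :
    ‖(a + L u + B u u) - (a + L v + B v v)‖ ≤ (lam + gam * (‖u‖ + ‖v‖)) * ‖u - v‖ := by
  have h : (a + L u + B u u) - (a + L v + B v v) = L (u - v) + B u (u - v) + B (u - v) v := by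
    simp only [map_sub, LinearMap.sub_apply]
    abel
  rw [h]
  calc ‖L (u - v) + B u (u - v) + B (u - v) v‖
      ≤ ‖L (u - v)‖ + ‖B u (u - v)‖ + ‖B (u - v) v‖ := norm_add₃_le
    _ ≤ lam * ‖u - v‖ + gam * ‖u‖ * ‖u - v‖ + gam * ‖u - v‖ * ‖v‖ := by
      gcongr
      · exact hL _
      · exact hB _ _
      · exact hB _ _
    _ = (lam + gam * (‖u‖ + ‖v‖)) * ‖u - v‖ := by ring

/-- The smaller root of `r = a + lam * r + gam * r ^ 2`. -/
theorem exists_root_lt_of_lt_sq_div {lam gam a : ℝ} (hlam : lam < 1) (hgam : 0 < gam) (ha0 : 0 ≤ a)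
    (ha : a < (1 - lam) ^ 2 / (4 * gam)) :
    ∃ r, 0 ≤ r ∧ 2 * gam * r < 1 - lam ∧ a + lam * r + gam * r ^ 2 = r := by
  have hd : 0 < (1 - lam) ^ 2 - 4 * gam * a := by
    rw [lt_div_iff₀ (by positivity)] at ha
    linarith
  have hs := Real.sqrt_pos.2 hd
  have hsq := Real.sq_sqrt hd.le
  set s := √((1 - lam) ^ 2 - 4 * gam * a)
  have hsc : s ≤ 1 - lam := by
    refine abs_le_of_sq_le_sq' ?_ (by linarith) |>.2
    have : 0 ≤ gam * a := by positivity
    linarith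
  refine ⟨(1 - lam - s) / (2 * gam), div_nonneg (by linarith) (by positivity), ?_, ?_⟩
  · rw [mul_div_cancel₀ _ (by positivity)]
    linarith
  · field_simp
    linear_combination hsq

/-- Picard iteration for `x = x₁ + L x + B x x` in a Banach space: if `L` is linear with
`‖L x‖ ≤ λ ‖x‖` for some `λ ∈ [0,1)`, and `B` is bilinear with `‖B x y‖ ≤ γ ‖x‖ ‖y‖` for some
`γ > 0`, then for every `x₁` with `‖x₁‖ < (1-λ)²/(4γ)`, the sequence `x⁽⁰⁾ = 0`,
`x⁽ⁿ⁺¹⁾ = x₁ + L x⁽ⁿ⁾ + B x⁽ⁿ⁾ x⁽ⁿ⁾` converges to a solution `y` of `y = x₁ + L y + B y y`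
with `2γ‖y‖ ≤ 1 - λ`, and `y` is the unique solution satisfying this smallness condition. -/
theorem picard_iteration_bilinear
    {X : Type*} [NormedAddCommGroup X] [NormedSpace ℝ X] [CompleteSpace X]
    (L : X →ₗ[ℝ] X) (B : X →ₗ[ℝ] X →ₗ[ℝ] X) (lam gam : ℝ)
    (hlam0 : 0 ≤ lam) (hlam : lam < 1) (hgam : 0 < gam)
    (hL : ∀ x : X, ‖L x‖ ≤ lam * ‖x‖)
    (hB : ∀ x y : X, ‖B x y‖ ≤ gam * ‖x‖ * ‖y‖)
    (x₁ : X) (hx₁ : ‖x₁‖ < (1 - lam) ^ 2 / (4 * gam))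
    (x : ℕ → X) (hx0 : x 0 = 0)
    (hxrec : ∀ n : ℕ, x (n + 1) = x₁ + L (x n) + B (x n) (x n)) :
    ∃ y : X, Tendsto x atTop (𝓝 y) ∧ y = x₁ + L y + B y y ∧ 2 * gam * ‖y‖ ≤ 1 - lam ∧
      ∀ z : X, z = x₁ + L z + B z z → 2 * gam * ‖z‖ ≤ 1 - lam → z = y := by
  obtain ⟨r, hr0, hr, hroot⟩ := exists_root_lt_of_lt_sq_div hlam hgam (norm_nonneg x₁) hx₁
  have hlip : ∀ u v : X, ‖u‖ ≤ r → ‖v‖ ≤ r →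
      ‖(x₁ + L u + B u u) - (x₁ + L v + B v v)‖ ≤ (lam + 2 * gam * r) * ‖u - v‖ := by
    intro u v hu hv
    refine (norm_picard_sub_le hL hB x₁ u v).trans ?_
    have h := mul_le_mul_of_nonneg_left (add_le_add hu hv) hgam.le
    exact mul_le_mul_of_nonneg_right (by linarith) (norm_nonneg _)
  have hbd : ∀ n, ‖x n‖ ≤ r := by
    intro n
    induction n with
    | zero => simpa [hx0] using hr0
    | succ n ih =>
      rw [hxrec]
      calc ‖x₁ + L (x n) + B (x n) (x n)‖
          ≤ ‖x₁‖ + ‖L (x n)‖ + ‖B (x n) (x n)‖ := norm_add₃_le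
        _ ≤ ‖x₁‖ + lam * ‖x n‖ + gam * ‖x n‖ * ‖x n‖ := by
          gcongr
          · exact hL _
          · exact hB _ _
        _ ≤ ‖x₁‖ + lam * r + gam * r * r := by gcongr
        _ = r := by linarith
  have hk0 : 0 ≤ lam + 2 * gam * r := by positivity
  have hstep : ∀ n, dist (x n) (x (n + 1)) ≤ ‖x 0 - x 1‖ * (lam + 2 * gam * r) ^ n := by
    intro n
    rw [dist_eq_norm]
    induction n with
    | zero => simp
    | succ n ih =>
      have h := hlip (x n) (x (n + 1)) (hbd n) (hbd (n + 1))
      rw [← hxrec, ← hxrec] at h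
      refine h.trans ((mul_le_mul_of_nonneg_left ih hk0).trans_eq ?_)
      ring
  obtain ⟨y, hy⟩ := cauchySeq_tendsto_of_complete
    (cauchySeq_of_le_geometric _ _ (by linarith) hstep)
  have hyr : ‖y‖ ≤ r := le_of_tendsto hy.norm (Eventually.of_forall hbd)
  have hfix : y = x₁ + L y + B y y := by
    refine tendsto_nhds_unique ((tendsto_add_atTop_iff_nat 1).2 hy) ?_
    rw [tendsto_iff_norm_sub_tendsto_zero]
    have h0 := (tendsto_iff_norm_sub_tendsto_zero.1 hy).const_mul (lam + 2 * gam * r)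
    rw [mul_zero] at h0
    refine squeeze_zero (fun _ => norm_nonneg _) (fun n => ?_) h0
    rw [hxrec]
    exact hlip _ _ (hbd n) hyr
  have hyb : 2 * gam * ‖y‖ < 1 - lam := lt_of_le_of_lt (by gcongr) hr
  refine ⟨y, hy, hfix, hyb.le, fun z hz hzb => ?_⟩
  have h := norm_picard_sub_le hL hB x₁ z y
  rw [← hz, ← hfix] at h
  by_contra hne
  have hpos : 0 < ‖z - y‖ := norm_pos_iff.2 (sub_ne_zero.2 hne)
  have hlt : lam + gam * (‖z‖ + ‖y‖) < 1 := by linarith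
  exact absurd h (not_le.2 (mul_lt_of_lt_one_left hpos hlt))
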